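/- Let L be a lattice of rank n, let (v_1,…,v_n) be a Minkowski-reduced basis of L, and let 8 ≤ k ≤ n. Then ‖v_k‖² ≤ (608/625)·(5/4)^{k−4}·λ_k(L)². -/

import Mathlib

open scoped BigOperators
noncomputable section

/-- Euclidean space ℝ^m. -/
abbrev E (m : ℕ) := EuclideanSpace ℝ (Fin m)

/-- `L` is a lattice of rank `n` in `ℝ^m`: a discrete additive subgroup spanning an
`n`-dimensional real subspace. -/
def IsLattice {m : ℕ} (L : AddSubgroup (E m)) (n : ℕ) : Prop :=
  DiscreteTopology L ∧ Module.finrank ℝ (Submodule.span ℝ (L : Set (E m))) = n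

/-- `b` is a basis of the lattice `L`: a tuple of vectors of `L` generating `L`
as a ℤ-module. -/
def IsLatticeBasis {m n : ℕ} (L : AddSubgroup (E m)) (b : Fin n → E m) : Prop :=
  (∀ i, b i ∈ L) ∧ (Submodule.span ℤ (Set.range b) : Set (E m)) = (L : Set (E m))

/-- `b` is a primitive tuple of vectors of `L`: it is linearly independent and
`span_ℤ(b) = span_ℝ(b) ∩ L`; equivalently, it can be extended to a basis of `L`. -/
def IsPrimitiveTuple {m k : ℕ} (L : AddSubgroup (E m)) (b : Fin k → E m) : Prop :=
  (∀ i, b i ∈ L) ∧ LinearIndependent ℝ b ∧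
  (Submodule.span ℤ (Set.range b) : Set (E m)) =
    (Submodule.span ℝ (Set.range b) : Set (E m)) ∩ (L : Set (E m))

/-- The first `i` entries of the tuple `v`. -/
def truncTuple {m n : ℕ} (v : Fin n → E m) (i : Fin n) : Fin i → E m :=
  fun j => v (Fin.castLE i.isLt.le j)

/-- `v` is a Minkowski-reduced basis of `L`: it is a basis and, for each `i`, `v i` has
minimal norm among all `w ∈ L` such that `(v 0, …, v (i-1), w)` is primitive. -/
def IsMinkowskiReduced {m n : ℕ} (L : AddSubgroup (E m)) (v : Fin n → E m) : Prop :=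
  IsLatticeBasis L v ∧ ∀ i : Fin n, ∀ w ∈ L,
    IsPrimitiveTuple L (Fin.snoc (truncTuple v i) w) → ‖v i‖ ≤ ‖w‖

/-- The `i`-th successive minimum `λ_i(L)`: the least `r ≥ 0` such that `L` contains
`i` linearly independent vectors of norm at most `r`. -/
def succMin {m : ℕ} (L : AddSubgroup (E m)) (i : ℕ) : ℝ :=
  sInf {r : ℝ | 0 ≤ r ∧ ∃ v : Fin i → E m,
    (∀ j, v j ∈ L) ∧ LinearIndependent ℝ v ∧ ∀ j, ‖v j‖ ≤ r}

/-- A nonzero integer tuple is a positive integer times a tuple admitting a Bézout relation. -/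
lemma exists_pos_mul_bezout {ι : Type*} (s : Finset ι) (z : ι → ℤ) (h : ∃ i ∈ s, z i ≠ 0) :
    ∃ g : ℤ, 0 < g ∧ ∃ z' : ι → ℤ, (∀ i ∈ s, z i = g * z' i) ∧
      ∃ c : ι → ℤ, ∑ i ∈ s, z' i * c i = 1 := by
  obtain ⟨i, hi, hz⟩ := h
  obtain ⟨z', hz', h1⟩ := s.extract_gcd z ⟨i, hi⟩
  refine ⟨s.gcd z, ?_, z', hz', ?_⟩
  · have h0 : 0 ≤ s.gcd z := Int.nonneg_of_normalize_eq_self Finset.normalize_gcd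
    have h2 : s.gcd z ≠ 0 := fun h => hz (by rw [hz' i hi, h, zero_mul])
    omega
  · obtain ⟨c, hc⟩ := s.gcd_eq_sum_mul z'
    exact ⟨c, by rw [← h1, hc]⟩

/-- Rounding one real coefficient to an integer increases the squared norm by at most
a quarter of the squared norm of the vector. -/
lemma exists_int_norm_sq_add_smul_le {V : Type*} [NormedAddCommGroup V] [InnerProductSpace ℝ V]
    (y v : V) (t : ℝ) : ∃ c : ℤ, ‖y + (t - c) • v‖ ^ 2 ≤ ‖y‖ ^ 2 + ‖v‖ ^ 2 / 4 := by
  have key : ∀ s : ℝ, ‖y + s • v‖ ^ 2 = ‖y‖ ^ 2 + 2 * s * inner ℝ y v + s ^ 2 * ‖v‖ ^ 2 := by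
    intro s
    rw [norm_add_sq_real, norm_smul, inner_smul_right, mul_pow, Real.norm_eq_abs, sq_abs]
    ring
  have hf : t - ⌊t⌋ = Int.fract t := rfl
  have h0 := Int.fract_nonneg t
  have h1 := (Int.fract_lt_one t).le
  by_contra! hcon
  have ha := hcon ⌊t⌋
  have hb := hcon (⌊t⌋ + 1)
  rw [key] at ha hb
  push_cast at hb
  rw [show t - ((⌊t⌋ : ℝ) + 1) = Int.fract t - 1 by rw [← hf]; ring] at hb
  rw [hf] at ha
  generalize Int.fract t = f at *
  generalize (inner ℝ y v : ℝ) = p at *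
  have hv : 0 ≤ ‖v‖ ^ 2 := by positivity
  generalize ‖v‖ ^ 2 = q at *
  rcases h1.lt_or_eq with h1 | rfl
  · nlinarith [mul_pos (sub_pos.2 h1) (sub_pos.2 ha), mul_nonneg h0 (sub_pos.2 hb).le,
      mul_nonneg hv (sq_nonneg (f - 1 / 2))]
  · linarith

/-- Rounding the coefficients of a real combination to integers increases the squared norm by at
most a quarter of the sum of the squared norms. -/
lemma exists_int_norm_sq_add_sum_le {V ι : Type*} [NormedAddCommGroup V] [InnerProductSpace ℝ V]
    (s : Finset ι) (y : V) (v : ι → V) (t : ι → ℝ) :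
    ∃ c : ι → ℤ, ‖y + ∑ i ∈ s, (t i - c i) • v i‖ ^ 2 ≤ ‖y‖ ^ 2 + (∑ i ∈ s, ‖v i‖ ^ 2) / 4 := by
  classical
  induction s using Finset.induction_on with
  | empty => exact ⟨0, by simp⟩
  | insert a s ha ih =>
    obtain ⟨c, hc⟩ := ih
    obtain ⟨d, hd⟩ := exists_int_norm_sq_add_smul_le (y + ∑ i ∈ s, (t i - c i) • v i) (v a) (t a)
    refine ⟨Function.update c a d, ?_⟩
    rw [Finset.sum_insert ha, Finset.sum_insert ha]
    have : ∑ i ∈ s, (t i - (Function.update c a d i : ℤ)) • v i = ∑ i ∈ s, (t i - c i) • v i := by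
      refine Finset.sum_congr rfl fun i hi => ?_
      rw [Function.update_of_ne (by rintro rfl; exact ha hi)]
    rw [this, Function.update_self, add_left_comm, add_comm (_ • _)]
    linarith

lemma mem_span_range_truncTuple {R : Type*} [Ring R] {m n : ℕ} [Module R (E m)]
    (v : Fin n → E m) (K : Fin n) (x : E m) :
    x ∈ Submodule.span R (Set.range (truncTuple v K)) ↔
      ∃ a : Fin n → R, (∀ i, K ≤ i → a i = 0) ∧ ∑ i, a i • v i = x := by
  classical
  constructor
  · intro hx
    induction hx using Submodule.span_induction with
    | mem x h =>
      obtain ⟨j, rfl⟩ := h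
      refine ⟨Pi.single (Fin.castLE K.isLt.le j) 1, fun i hi => ?_, ?_⟩
      · rw [Pi.single_eq_of_ne]
        rintro rfl
        have := j.isLt
        simp only [Fin.le_def, Fin.val_castLE] at hi
        omega
      · simp [Pi.single_apply, ite_smul, truncTuple]
    | zero => exact ⟨0, by simp, by simp⟩
    | add x y _ _ hx hy =>
      obtain ⟨a, ha, rfl⟩ := hx
      obtain ⟨b, hb, rfl⟩ := hy
      exact ⟨a + b, fun i hi => by simp [ha i hi, hb i hi],
        by simp [add_smul, Finset.sum_add_distrib]⟩
    | smul r x _ hx =>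
      obtain ⟨a, ha, rfl⟩ := hx
      exact ⟨r • a, fun i hi => by simp [ha i hi], by simp [Finset.smul_sum, mul_smul]⟩
  · rintro ⟨a, ha, rfl⟩
    refine Submodule.sum_mem _ fun i _ => ?_
    by_cases hi : K ≤ i
    · simp [ha i hi]
    · exact Submodule.smul_mem _ _ (Submodule.subset_span ⟨⟨i, not_le.1 hi⟩, rfl⟩)

section LatticeBasis

variable {m n : ℕ} {L : AddSubgroup (E m)} {v : Fin n → E m}

lemma IsLatticeBasis.mem_iff (hv : IsLatticeBasis L v) (x : E m) :
    x ∈ L ↔ ∃ z : Fin n → ℤ, ∑ i, (z i : ℝ) • v i = x := by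
  rw [← SetLike.mem_coe, ← hv.2, SetLike.mem_coe, Submodule.mem_span_range_iff_exists_fun]
  simp only [Int.cast_smul_eq_zsmul]

lemma IsLatticeBasis.linearIndependent (hL : IsLattice L n) (hv : IsLatticeBasis L v) :
    LinearIndependent ℝ v := by
  rw [linearIndependent_iff_card_eq_finrank_span, Fintype.card_fin, Set.finrank,
    ← Submodule.span_span_of_tower ℤ ℝ, hv.2]
  exact hL.2.symm

lemma LinearIndependent.coeff_eq (hli : LinearIndependent ℝ v) {a b : Fin n → ℝ}
    (h : ∑ i, a i • v i = ∑ i, b i • v i) (i : Fin n) : a i = b i := by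
  have := Fintype.linearIndependent_iff.1 hli (fun i => a i - b i)
    (by simp [sub_smul, Finset.sum_sub_distrib, h]) i
  linarith

/-- A lattice vector whose tail of coordinates satisfies a Bézout relation extends the initial
segment of the basis to a primitive tuple. -/
lemma IsLatticeBasis.isPrimitiveTuple_snoc (hv : IsLatticeBasis L v)
    (hli : LinearIndependent ℝ v) (K : Fin n) (z c : Fin n → ℤ)
    (hc : ∑ i with K ≤ i, z i * c i = 1) :
    IsPrimitiveTuple L (Fin.snoc (truncTuple v K) (∑ i, (z i : ℝ) • v i)) := by
  have hmem : ∀ j, (Fin.snoc (truncTuple v K) (∑ i, (z i : ℝ) • v i) : Fin (K + 1) → E m) j ∈ L := by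
    intro j
    refine Fin.lastCases ?_ (fun j => ?_) j
    · simpa using (hv.mem_iff _).2 ⟨z, rfl⟩
    · rw [Fin.snoc_castSucc]
      exact hv.1 _
  refine ⟨hmem, ?_, ?_⟩
  · rw [linearIndependent_finSnoc]
    refine ⟨hli.comp _ (Fin.castLE_injective _), ?_⟩
    rw [mem_span_range_truncTuple]
    rintro ⟨a, ha, h⟩
    have hz : ∀ i, K ≤ i → z i = 0 := fun i hi => by
      have := hli.coeff_eq h i
      rw [ha i hi] at this
      exact_mod_cast this.symm
    rw [Finset.sum_eq_zero] at hc
    · exact zero_ne_one hc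
    · intro i hi
      rw [hz i (by simpa using hi), zero_mul]
  · refine Set.Subset.antisymm (Set.subset_inter (Submodule.span_subset_span ℤ ℝ _) ?_) ?_
    · have : Submodule.span ℤ (Set.range (Fin.snoc (truncTuple v K) (∑ i, (z i : ℝ) • v i) :
          Fin (K + 1) → E m)) ≤ AddSubgroup.toIntSubmodule L := by
        rw [Submodule.span_le]
        rintro _ ⟨j, rfl⟩
        exact hmem j
      exact this
    · rintro x ⟨hx, hxL⟩
      rw [SetLike.mem_coe] at hx ⊢
      rw [Fin.range_snoc, Submodule.mem_span_insert] at hx ⊢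
      obtain ⟨s, y, hy, hxy⟩ := hx
      obtain ⟨a, ha, rfl⟩ := (mem_span_range_truncTuple v K y).1 hy
      obtain ⟨b, hb⟩ := (hv.mem_iff x).1 hxL
      have hco : ∀ i, (b i : ℝ) = s * z i + a i := by
        refine hli.coeff_eq ?_
        rw [hb, hxy]
        simp [add_smul, Finset.sum_add_distrib, mul_smul, Finset.smul_sum]
      have hs : s = ((∑ i with K ≤ i, b i * c i : ℤ) : ℝ) := by
        have h1 : ((∑ i with K ≤ i, z i * c i : ℤ) : ℝ) = 1 := by exact_mod_cast hc
        rw [← mul_one s, ← h1]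
        push_cast
        rw [Finset.mul_sum]
        refine Finset.sum_congr rfl fun i hi => ?_
        rw [hco i, ha i (by simpa using hi)]
        ring
      set t : ℤ := ∑ i with K ≤ i, b i * c i
      refine ⟨t, ∑ i, (b i - t * z i) • v i, ?_, ?_⟩
      · refine (mem_span_range_truncTuple v K _).2 ⟨_, fun i hi => ?_, rfl⟩
        have := hco i
        rw [ha i hi, hs, add_zero] at this
        have : b i = t * z i := by exact_mod_cast this
        omega
      · rw [← hb, ← Int.cast_smul_eq_zsmul ℝ t, Finset.smul_sum, ← Finset.sum_add_distrib]
        refine Finset.sum_congr rfl fun i _ => ?_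
        rw [← Int.cast_smul_eq_zsmul ℝ (b i - t * z i), smul_smul, ← add_smul]
        push_cast
        congr 1
        ring

/-- The sum of the squared norms of the first `j` entries of a tuple. -/
def sqNormSum (v : Fin n → E m) (j : ℕ) : ℝ := ∑ i : Fin n with i.val < j, ‖v i‖ ^ 2

lemma sqNormSum_zero (v : Fin n → E m) : sqNormSum v 0 = 0 := by simp [sqNormSum]

lemma sqNormSum_succ (v : Fin n → E m) (j : Fin n) :
    sqNormSum v (j + 1) = sqNormSum v j + ‖v j‖ ^ 2 := by
  have : (Finset.univ.filter fun i : Fin n => i.val < j.val + 1) =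
      insert j (Finset.univ.filter fun i : Fin n => i.val < j.val) := by
    ext i
    simp [Fin.ext_iff]
    omega
  rw [sqNormSum, this, Finset.sum_insert (by simp), add_comm, sqNormSum]

namespace IsMinkowskiReduced

lemma norm_le_of_bezout (hv : IsMinkowskiReduced L v) (hli : LinearIndependent ℝ v)
    (K : Fin n) (z c : Fin n → ℤ) (hc : ∑ i with K ≤ i, z i * c i = 1) :
    ‖v K‖ ≤ ‖∑ i, (z i : ℝ) • v i‖ :=
  hv.2 K _ ((hv.1.mem_iff _).2 ⟨z, rfl⟩) (hv.1.isPrimitiveTuple_snoc hli K z c hc)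

/-- If the coordinates of a lattice vector from `j ≤ K` on are `g` times a tuple satisfying a
Bézout relation from `K` on, then dividing by `g` and rounding the first `j` coordinates
bounds `‖v K‖`. -/
lemma norm_sq_le_of_eq_mul (hv : IsMinkowskiReduced L v) (hli : LinearIndependent ℝ v)
    {j K : Fin n} (hjK : j ≤ K) (z z' c : Fin n → ℤ) {g : ℤ} (hg : 0 < g)
    (hz : ∀ i, j ≤ i → z i = g * z' i) (hc : ∑ i with K ≤ i, z' i * c i = 1) :
    ‖v K‖ ^ 2 ≤ ‖∑ i, (z i : ℝ) • v i‖ ^ 2 / (g : ℝ) ^ 2 + sqNormSum v j / 4 := by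
  have hg' : (0 : ℝ) < g := by exact_mod_cast hg
  obtain ⟨d, hd⟩ := exists_int_norm_sq_add_sum_le (Finset.univ.filter fun i : Fin n => i < j)
    ((g : ℝ)⁻¹ • ∑ i, (z i : ℝ) • v i) v (fun i => -(z i : ℝ) / g)
  have hu : (g : ℝ)⁻¹ • ∑ i, (z i : ℝ) • v i +
      ∑ i with i < j, (-(z i : ℝ) / g - d i) • v i =
      ∑ i, ((if i < j then -d i else z' i : ℤ) : ℝ) • v i := by
    rw [Finset.sum_filter, Finset.smul_sum, ← Finset.sum_add_distrib]
    refine Finset.sum_congr rfl fun i _ => ?_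
    split_ifs with h
    · rw [smul_smul, ← add_smul]
      congr 1
      push_cast
      field_simp
      ring
    · rw [smul_smul, add_zero, hz i (not_lt.1 h)]
      congr 1
      push_cast
      field_simp
  have hle := hv.norm_le_of_bezout hli K (fun i => if i < j then -d i else z' i) c (by
    rw [← hc]
    refine Finset.sum_congr rfl fun i hi => ?_
    rw [if_neg (not_lt.2 (hjK.trans (by simpa using hi)))])
  rw [hu, norm_smul, mul_pow, norm_inv, inv_pow, Real.norm_eq_abs, sq_abs] at hd
  calc ‖v K‖ ^ 2 ≤ _ := pow_le_pow_left₀ (norm_nonneg _) hle 2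
    _ ≤ _ := hd
    _ = _ := by rw [sqNormSum, div_eq_inv_mul (‖_‖ ^ 2)]; rfl

lemma norm_sq_le_or (hv : IsMinkowskiReduced L v) (hli : LinearIndependent ℝ v) (K : Fin n)
    (z : Fin n → ℤ) (hz : ∃ i, K ≤ i ∧ z i ≠ 0) {r : ℝ} (hr : ‖∑ i, (z i : ℝ) • v i‖ ≤ r) :
    ‖v K‖ ^ 2 ≤ r ^ 2 ∨ ‖v K‖ ^ 2 ≤ r ^ 2 / 4 + sqNormSum v K / 4 := by
  have hr2 := pow_le_pow_left₀ (norm_nonneg _) hr 2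
  obtain ⟨g, hg, z', hz', c, hc⟩ := exists_pos_mul_bezout (Finset.univ.filter fun i => K ≤ i) z
    (by simpa using hz)
  simp only [Finset.mem_filter, Finset.mem_univ, true_and] at hz'
  rcases (show g = 1 ∨ 2 ≤ g by omega) with rfl | hg2
  · left
    have := hv.norm_le_of_bezout hli K z c (by
      rw [← hc]
      exact Finset.sum_congr rfl fun i hi => by rw [hz' i (by simpa using hi), one_mul])
    exact pow_le_pow_left₀ (norm_nonneg _) (this.trans hr) 2
  · right
    refine (hv.norm_sq_le_of_eq_mul hli le_rfl z z' c hg hz' hc).trans ?_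
    have : (2 : ℝ) ≤ g := by exact_mod_cast hg2
    gcongr
    nlinarith

lemma norm_sq_le_or_of_le (hv : IsMinkowskiReduced L v) (hli : LinearIndependent ℝ v)
    {j K : Fin n} (hjK : j ≤ K) (z : Fin n → ℤ) (hz : ∃ i, K ≤ i ∧ z i ≠ 0) {r : ℝ}
    (hr : ‖∑ i, (z i : ℝ) • v i‖ ≤ r) :
    ‖v j‖ ^ 2 ≤ r ^ 2 ∨ ‖v K‖ ^ 2 ≤ r ^ 2 / 4 + sqNormSum v j / 4 ∨
      ‖v K‖ ^ 2 ≤ r ^ 2 / 16 + sqNormSum v K / 4 := by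
  have hr2 := pow_le_pow_left₀ (norm_nonneg _) hr 2
  obtain ⟨l, hl, hzl⟩ := hz
  obtain ⟨g, hg, z', hz', c, hc⟩ := exists_pos_mul_bezout (Finset.univ.filter fun i => j ≤ i) z
    ⟨l, by simpa using hjK.trans hl, hzl⟩
  simp only [Finset.mem_filter, Finset.mem_univ, true_and] at hz'
  rcases (show g = 1 ∨ 2 ≤ g by omega) with rfl | hg2
  · left
    have := hv.norm_le_of_bezout hli j z c (by
      rw [← hc]
      exact Finset.sum_congr rfl fun i hi => by rw [hz' i (by simpa using hi), one_mul])
    exact pow_le_pow_left₀ (norm_nonneg _) (this.trans hr) 2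
  right
  obtain ⟨h, hh, z'', hz'', d, hd⟩ := exists_pos_mul_bezout
    (Finset.univ.filter fun i => K ≤ i) z' ⟨l, by simpa using hl, fun h0 => hzl (by
      rw [hz' l (hjK.trans hl), h0, mul_zero])⟩
  simp only [Finset.mem_filter, Finset.mem_univ, true_and] at hz''
  have hg2' : (2 : ℝ) ≤ g := by exact_mod_cast hg2
  rcases (show h = 1 ∨ 2 ≤ h by omega) with rfl | hh2
  · left
    refine (hv.norm_sq_le_of_eq_mul hli hjK z z' d hg hz' ?_).trans ?_
    · rw [← hd]
      exact Finset.sum_congr rfl fun i hi => by rw [hz'' i (by simpa using hi), one_mul]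
    · gcongr
      nlinarith
  · right
    refine (hv.norm_sq_le_of_eq_mul hli le_rfl z z'' d (mul_pos hg hh) (fun i hi => ?_) hd).trans ?_
    · rw [hz' i (hjK.trans hi), hz'' i hi, mul_assoc]
    · have hh2' : (2 : ℝ) ≤ h := by exact_mod_cast hh2
      have : (4 : ℝ) ≤ g * h := by nlinarith
      push_cast
      gcongr
      nlinarith

end IsMinkowskiReduced

/-- Among `k > K` linearly independent lattice vectors, one lies outside the span of the first `K`
basis vectors. -/
lemma IsLatticeBasis.exists_coeff_ne_zero (hv : IsLatticeBasis L v) {k : ℕ} {w : Fin k → E m}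
    (hw : ∀ i, w i ∈ L) (hli : LinearIndependent ℝ w) (K : Fin n) (hK : K.val < k) :
    ∃ l, ∃ z : Fin n → ℤ, ∑ i, (z i : ℝ) • v i = w l ∧ ∃ i, K ≤ i ∧ z i ≠ 0 := by
  by_contra! hcon
  have hsub : Set.range w ⊆ Submodule.span ℝ (Set.range (truncTuple v K)) := by
    rintro _ ⟨l, rfl⟩
    obtain ⟨z, hz⟩ := (hv.mem_iff _).1 (hw l)
    exact (mem_span_range_truncTuple v K _).2
      ⟨fun i => z i, fun i hi => by simp [hcon l z hz i hi], hz⟩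
  have h1 := Submodule.finrank_mono (Submodule.span_le.2 hsub)
  rw [finrank_span_eq_card hli, Fintype.card_fin] at h1
  have h2 := finrank_range_le_card (R := ℝ) (truncTuple v K)
  rw [Fintype.card_fin, Set.finrank] at h2
  omega

/-- The bound on `‖v_k‖` in terms of any bound on the norms of `k` independent lattice vectors. -/
lemma IsMinkowskiReduced.norm_sq_le_of_linearIndependent (hv : IsMinkowskiReduced L v)
    (hli : LinearIndependent ℝ v) {k : ℕ} {w : Fin k → E m} (hw : ∀ i, w i ∈ L)
    (hwli : LinearIndependent ℝ w) {r : ℝ} (hwr : ∀ i, ‖w i‖ ≤ r) (hk : 8 ≤ k) (hkn : k - 1 < n) :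
    ‖v ⟨k - 1, hkn⟩‖ ^ 2 ≤ (608 / 625 : ℝ) * (5 / 4 : ℝ) ^ (k - 4) * r ^ 2 := by
  have hA : ∀ K (h : K < k), ‖v ⟨K, by omega⟩‖ ^ 2 ≤ r ^ 2 ∨
      ‖v ⟨K, by omega⟩‖ ^ 2 ≤ r ^ 2 / 4 + sqNormSum v K / 4 := by
    intro K h
    obtain ⟨l, z, hz, hne⟩ := hv.1.exists_coeff_ne_zero hw hwli ⟨K, by omega⟩ h
    exact hv.norm_sq_le_or hli _ z hne (hz ▸ hwr l)
  have hB : ∀ j K (hj : j ≤ K) (h : K < k), ‖v ⟨j, by omega⟩‖ ^ 2 ≤ r ^ 2 ∨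
      ‖v ⟨K, by omega⟩‖ ^ 2 ≤ r ^ 2 / 4 + sqNormSum v j / 4 ∨
      ‖v ⟨K, by omega⟩‖ ^ 2 ≤ r ^ 2 / 16 + sqNormSum v K / 4 := by
    intro j K hj h
    obtain ⟨l, z, hz, hne⟩ := hv.1.exists_coeff_ne_zero hw hwli ⟨K, by omega⟩ h
    exact hv.norm_sq_le_or_of_le hli (j := ⟨j, by omega⟩) (by simpa using hj) z hne (hz ▸ hwr l)
  have hS : ∀ j (h : j < k), sqNormSum v (j + 1) = sqNormSum v j + ‖v ⟨j, by omega⟩‖ ^ 2 :=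
    fun j h => sqNormSum_succ v ⟨j, by omega⟩
  have hr : 0 ≤ r ^ 2 := sq_nonneg r
  have S0 := sqNormSum_zero v
  have S1 := hS 0 (by omega)
  have S2 := hS 1 (by omega)
  have S3 := hS 2 (by omega)
  have S4 := hS 3 (by omega)
  have S5 := hS 4 (by omega)
  have S6 := hS 5 (by omega)
  have S7 := hS 6 (by omega)
  norm_num at S1 S2 S3 S4 S5 S6 S7
  have b0 : ‖v ⟨0, by omega⟩‖ ^ 2 ≤ r ^ 2 := by
    rcases hA 0 (by omega) with h | h <;> linarith
  have b1 : ‖v ⟨1, by omega⟩‖ ^ 2 ≤ r ^ 2 := by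
    rcases hA 1 (by omega) with h | h <;> linarith
  have b2 : ‖v ⟨2, by omega⟩‖ ^ 2 ≤ r ^ 2 := by
    rcases hA 2 (by omega) with h | h <;> linarith
  have b3 : ‖v ⟨3, by omega⟩‖ ^ 2 ≤ r ^ 2 := by
    rcases hA 3 (by omega) with h | h <;> linarith
  have b4 : ‖v ⟨4, by omega⟩‖ ^ 2 ≤ 5 / 4 * r ^ 2 := by
    rcases hA 4 (by omega) with h | h <;> linarith
  have b5 : ‖v ⟨4, by omega⟩‖ ^ 2 ≤ r ^ 2 ∧ ‖v ⟨5, by omega⟩‖ ^ 2 ≤ 3 / 2 * r ^ 2 ∨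
      ‖v ⟨5, by omega⟩‖ ^ 2 ≤ 11 / 8 * r ^ 2 := by
    rcases hB 4 5 (by omega) (by omega) with h | h | h
    · left
      rcases hA 5 (by omega) with h' | h' <;> constructor <;> linarith
    · right; linarith
    · right; linarith
  have b6 : ‖v ⟨6, by omega⟩‖ ^ 2 ≤ 7 / 4 * r ^ 2 := by
    rcases hA 6 (by omega) with h | h
    · linarith
    rcases hB 5 6 (by omega) (by omega) with h5 | h5 | h5
    · rcases hB 4 6 (by omega) (by omega) with h4 | h4 | h4 <;>
        rcases b5 with ⟨_, _⟩ | _ <;> linarith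
    · linarith
    · rcases hB 4 6 (by omega) (by omega) with h4 | h4 | h4 <;>
        rcases b5 with ⟨_, _⟩ | _ <;> linarith
  have hsum : ∀ j, 7 + j ≤ k → r ^ 2 + sqNormSum v (7 + j) ≤ 19 / 2 * (5 / 4) ^ j * r ^ 2 ∧
      ∀ h : 7 + j < k, ‖v ⟨7 + j, by omega⟩‖ ^ 2 ≤ 19 / 8 * (5 / 4) ^ j * r ^ 2 := by
    have step : ∀ j, r ^ 2 + sqNormSum v (7 + j) ≤ 19 / 2 * (5 / 4) ^ j * r ^ 2 →
        ∀ h : 7 + j < k, ‖v ⟨7 + j, by omega⟩‖ ^ 2 ≤ 19 / 8 * (5 / 4) ^ j * r ^ 2 := by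
      intro j hj h
      have : (1 : ℝ) ≤ (5 / 4) ^ j := one_le_pow₀ (by norm_num)
      rcases hA (7 + j) h with h' | h'
      · nlinarith
      · linarith
    intro j
    induction j with
    | zero =>
      intro _
      have h0 : r ^ 2 + sqNormSum v (7 + 0) ≤ 19 / 2 * (5 / 4) ^ 0 * r ^ 2 := by
        norm_num
        rcases b5 with ⟨_, _⟩ | _ <;> linarith
      exact ⟨h0, step 0 h0⟩
    | succ j ih =>
      intro hj
      obtain ⟨h1, h2⟩ := ih (by omega)
      have h3 := h2 (by omega)
      have h4 : r ^ 2 + sqNormSum v (7 + (j + 1)) ≤ 19 / 2 * (5 / 4) ^ (j + 1) * r ^ 2 := by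
        rw [← add_assoc, hS (7 + j) (by omega), pow_succ (5 / 4 : ℝ) j]
        linarith
      exact ⟨h4, step _ h4⟩
  obtain ⟨j, rfl⟩ : ∃ j, k = 7 + j + 1 := ⟨k - 8, by omega⟩
  have := (hsum j (by omega)).2 (by omega)
  rw [show 7 + j + 1 - 4 = j + 4 by omega, pow_add]
  simp only [Nat.add_sub_cancel]
  linarith

end LatticeBasis

/-- If `L` is a lattice of rank `n`, `v` a Minkowski-reduced basis of `L`,
and `8 ≤ k ≤ n`, then `‖v_k‖² ≤ (608/625)·(5/4)^(k-4)·λ_k(L)²`. -/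
theorem minkowski_general_bound {m n : ℕ} (L : AddSubgroup (E m)) (hL : IsLattice L n)
    (v : Fin n → E m) (hv : IsMinkowskiReduced L v) (k : ℕ) (hk : 8 ≤ k) (hkn : k ≤ n) :
    ‖v ⟨k - 1, by omega⟩‖ ^ 2 ≤
      (608 / 625 : ℝ) * (5 / 4 : ℝ) ^ (k - 4) * (succMin L k) ^ 2 := by
  have hli := hv.1.linearIndependent hL
  set C : ℝ := (608 / 625 : ℝ) * (5 / 4 : ℝ) ^ (k - 4) with hC
  have hCpos : 0 < C := by positivity
  have hle : ‖v ⟨k - 1, by omega⟩‖ / √C ≤ succMin L k := by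
    refine le_csInf ⟨∑ i, ‖v i‖, by positivity, v ∘ Fin.castLE hkn, fun j => hv.1.1 _,
      hli.comp _ (Fin.castLE_injective _), fun j => ?_⟩ ?_
    · exact Finset.single_le_sum (f := fun i => ‖v i‖) (fun i _ => norm_nonneg _)
        (Finset.mem_univ _)
    · rintro r ⟨hr, w, hw, hwli, hwr⟩
      have := hv.norm_sq_le_of_linearIndependent hli hw hwli hwr hk (by omega)
      rw [div_le_iff₀ (by positivity)]
      refine le_of_sq_le_sq ?_ (by positivity)
      rwa [mul_pow, Real.sq_sqrt hCpos.le, mul_comm]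
  have h := pow_le_pow_left₀ (by positivity) hle 2
  rw [div_pow, Real.sq_sqrt hCpos.le, div_le_iff₀ hCpos] at h
  linarith
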